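/- The operations on endogenies pass to the quotient by ∼: if φ, φ', ψ, ψ' are endogenies of an abelian group A with φ ∼ φ' and ψ ∼ ψ', then φ + ψ ∼ φ' + ψ' and φ ∘ ψ ∼ φ' ∘ ψ'. -/

import Mathlib

open Pointwise

variable {A : Type*} [AddCommGroup A]

/-- `φ` is (the underlying set of) an additive subgroup of `A × A`. -/
def IsSubgroupRel (φ : Set (A × A)) : Prop :=
  (0 : A × A) ∈ φ ∧ (∀ x ∈ φ, ∀ y ∈ φ, x + y ∈ φ) ∧ ∀ x ∈ φ, -x ∈ φ

/-- The katakernel `kat φ = {b : (0, b) ∈ φ}`. -/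
def kat (φ : Set (A × A)) : Set A := {b | ((0 : A), b) ∈ φ}

/-- The image `φ[S] = {b : ∃ a ∈ S, (a, b) ∈ φ}`. -/
def img (φ : Set (A × A)) (S : Set A) : Set A := {b | ∃ a ∈ S, (a, b) ∈ φ}

/-- An endogeny of `A`: a total additive subgroup of `A × A` with finite katakernel. -/
def IsEndogeny (φ : Set (A × A)) : Prop :=
  IsSubgroupRel φ ∧ (∀ a : A, ∃ b, (a, b) ∈ φ) ∧ (kat φ).Finite

/-- The sum `φ + ψ` of two endogenies. -/
def esum (φ ψ : Set (A × A)) : Set (A × A) :=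
  {p | ∃ b₁ b₂, (p.1, b₁) ∈ φ ∧ (p.1, b₂) ∈ ψ ∧ p.2 = b₁ + b₂}

/-- The composition `φ ∘ ψ` of two endogenies. -/
def ecomp (φ ψ : Set (A × A)) : Set (A × A) :=
  {p | ∃ b, (p.1, b) ∈ ψ ∧ (b, p.2) ∈ φ}

/-- The negation `-φ` of an endogeny. -/
def eneg (φ : Set (A × A)) : Set (A × A) := {p | (p.1, -p.2) ∈ φ}

/-- `φ ∼ ψ` iff `(φ + (-ψ))[A]` is finite. -/
def eequiv (φ ψ : Set (A × A)) : Prop := (img (esum φ (eneg ψ)) Set.univ).Finite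

theorem eequiv_iff_finite_sub {φ ψ : Set (A × A)} :
    eequiv φ ψ ↔ {d | ∃ a b c, (a, b) ∈ φ ∧ (a, c) ∈ ψ ∧ b - c = d}.Finite := by
  have h : img (esum φ (eneg ψ)) Set.univ = {d | ∃ a b c, (a, b) ∈ φ ∧ (a, c) ∈ ψ ∧ b - c = d} := by
    ext d
    constructor
    · rintro ⟨a, -, b, c, hb, hc, rfl⟩
      exact ⟨a, b, -c, hb, hc, sub_neg_eq_add b c⟩
    · rintro ⟨a, b, c, hb, hc, rfl⟩
      exact ⟨a, trivial, b, -c, hb, by simpa [eneg] using hc, sub_eq_add_neg b c⟩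
  rw [eequiv, h]

theorem IsSubgroupRel.sub_mem {φ : Set (A × A)} (hφ : IsSubgroupRel φ) {x y : A × A}
    (hx : x ∈ φ) (hy : y ∈ φ) : x - y ∈ φ := by
  rw [sub_eq_add_neg]
  exact hφ.2.1 _ hx _ (hφ.2.2 _ hy)

theorem IsEndogeny.finite_img {φ : Set (A × A)} (hφ : IsEndogeny φ) {S : Set A}
    (hS : S.Finite) : (img φ S).Finite := by
  obtain ⟨hsub, htot, hkat⟩ := hφ
  choose f hf using htot
  refine ((hS.image f).add hkat).subset ?_
  rintro b ⟨a, ha, hab⟩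
  refine ⟨f a, ⟨a, ha, rfl⟩, b - f a, ?_, add_sub_cancel _ _⟩
  simpa [kat] using hsub.sub_mem hab (hf a)

theorem eequiv.esum_congr {φ φ' ψ ψ' : Set (A × A)} (h1 : eequiv φ φ') (h2 : eequiv ψ ψ') :
    eequiv (esum φ ψ) (esum φ' ψ') := by
  rw [eequiv_iff_finite_sub] at *
  refine (h1.add h2).subset ?_
  rintro d ⟨a, b, c, ⟨b₁, b₂, hb₁, hb₂, hb⟩, ⟨c₁, c₂, hc₁, hc₂, hc⟩, rfl⟩
  dsimp only at hb hc
  subst hb hc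
  exact ⟨b₁ - c₁, ⟨a, b₁, c₁, hb₁, hc₁, rfl⟩, b₂ - c₂, ⟨a, b₂, c₂, hb₂, hc₂, rfl⟩,
    sub_add_sub_comm b₁ c₁ b₂ c₂⟩

theorem eequiv.ecomp_congr {φ φ' ψ ψ' : Set (A × A)} (hφ' : IsEndogeny φ')
    (h1 : eequiv φ φ') (h2 : eequiv ψ ψ') : eequiv (ecomp φ ψ) (ecomp φ' ψ') := by
  rw [eequiv_iff_finite_sub] at *
  refine (h1.add (hφ'.finite_img h2)).subset ?_
  rintro d ⟨a, c, c', ⟨b, hab, hbc⟩, ⟨b', hab', hbc'⟩, rfl⟩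
  obtain ⟨e, he⟩ := hφ'.2.1 b
  exact ⟨c - e, ⟨b, c, e, hbc, he, rfl⟩, e - c',
    ⟨b - b', ⟨a, b, b', hab, hab', rfl⟩, hφ'.1.sub_mem he hbc'⟩, sub_add_sub_cancel c e c'⟩

theorem eequiv_congr_sum_comp (φ φ' ψ ψ' : Set (A × A))
    (hφ : IsEndogeny φ) (hφ' : IsEndogeny φ') (hψ : IsEndogeny ψ) (hψ' : IsEndogeny ψ')
    (h1 : eequiv φ φ') (h2 : eequiv ψ ψ') :
    eequiv (esum φ ψ) (esum φ' ψ') ∧ eequiv (ecomp φ ψ) (ecomp φ' ψ') := by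
  exact ⟨h1.esum_congr h2, h1.ecomp_congr hφ' h2⟩
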